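/- Let α, d_1, …, d_r ∈ ℝ^ρ and let c_1, …, c_r be nonnegative reals. Then the convex cone in ℝ² × ℝ^ρ generated by the vectors ((0,0), d_i) and ((0, c_i), d_i) for 1 ≤ i ≤ r, together with ((1,0), α), equals the set {((a, b), a·α + t_1 d_1 + ⋯ + t_r d_r) : a ≥ 0, t_1, …, t_r ≥ 0, 0 ≤ b ≤ t_1 c_1 + ⋯ + t_r c_r}. In particular, if α, the d_i and the c_i are rational, this set is a rational polyhedral convex cone. -/

import Mathlib

open Pointwise

/-- The convex cone generated by a set `Q`: all finite nonnegative linear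
combinations of elements of `Q` (the empty combination giving `0`). -/
def coneGen {E : Type*} [AddCommMonoid E] [Module ℝ E] (Q : Set E) : Set E :=
  {x | ∃ (k : ℕ) (c : Fin k → ℝ) (g : Fin k → E),
    (∀ i, 0 ≤ c i) ∧ (∀ i, g i ∈ Q) ∧ x = ∑ i, c i • g i}

section ConeGen

variable {E : Type*} [AddCommMonoid E] [Module ℝ E] {Q : Set E}

theorem zero_mem_coneGen : (0 : E) ∈ coneGen Q :=
  ⟨0, Fin.elim0, Fin.elim0, fun i => i.elim0, fun i => i.elim0, by simp⟩

theorem smul_mem_coneGen {a : ℝ} {x : E} (ha : 0 ≤ a) (hx : x ∈ Q) : a • x ∈ coneGen Q :=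
  ⟨1, fun _ => a, fun _ => x, fun _ => ha, fun _ => hx, by simp⟩

theorem add_mem_coneGen {x y : E} (hx : x ∈ coneGen Q) (hy : y ∈ coneGen Q) :
    x + y ∈ coneGen Q := by
  obtain ⟨k, c, g, hc, hg, rfl⟩ := hx
  obtain ⟨l, c', g', hc', hg', rfl⟩ := hy
  refine ⟨k + l, Fin.append c c', Fin.append g g', fun i => ?_, fun i => ?_, ?_⟩
  · induction i using Fin.addCases <;> simp [hc, hc']
  · induction i using Fin.addCases <;> simp [hg, hg']
  · simp [Fin.sum_univ_add]

theorem sum_mem_coneGen {ι : Type*} (s : Finset ι) {f : ι → E} (hf : ∀ i ∈ s, f i ∈ coneGen Q) :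
    ∑ i ∈ s, f i ∈ coneGen Q :=
  Finset.sum_induction f (· ∈ coneGen Q) (fun _ _ => add_mem_coneGen) zero_mem_coneGen hf

theorem coneGen_subset {S : Set E} (h0 : (0 : E) ∈ S)
    (hadd : ∀ x y, x ∈ S → y ∈ S → x + y ∈ S)
    (hsmul : ∀ a : ℝ, 0 ≤ a → ∀ x ∈ Q, a • x ∈ S) : coneGen Q ⊆ S := by
  rintro _ ⟨k, c, g, hc, hg, rfl⟩
  exact Finset.sum_induction _ (· ∈ S) hadd h0 fun i _ => hsmul _ (hc i) _ (hg i)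

end ConeGen

/-- Let `α, d 1, …, d r ∈ ℝ^ρ` and let `c 1, …, c r` be nonnegative reals.  The
convex cone in `ℝ² × ℝ^ρ` generated by the vectors `((0,0), dᵢ)`, `((0, cᵢ), dᵢ)`
for `1 ≤ i ≤ r` together with `((1,0), α)` equals
`{((a, b), a·α + t₁ d₁ + ⋯ + tᵣ dᵣ) : a ≥ 0, tᵢ ≥ 0, 0 ≤ b ≤ t₁ c₁ + ⋯ + tᵣ cᵣ}`. -/
theorem stmt_8 (ρ r : ℕ) (α : Fin ρ → ℝ) (d : Fin r → (Fin ρ → ℝ))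
    (c : Fin r → ℝ) (hc : ∀ i, 0 ≤ c i) :
    coneGen (({p : (ℝ × ℝ) × (Fin ρ → ℝ) | ∃ i : Fin r, p = (((0 : ℝ), (0 : ℝ)), d i)}
        ∪ {p : (ℝ × ℝ) × (Fin ρ → ℝ) | ∃ i : Fin r, p = (((0 : ℝ), c i), d i)})
        ∪ {(((1 : ℝ), (0 : ℝ)), α)})
      = {p : (ℝ × ℝ) × (Fin ρ → ℝ) | ∃ (a b : ℝ) (t : Fin r → ℝ),
          0 ≤ a ∧ (∀ i, 0 ≤ t i) ∧ 0 ≤ b ∧ b ≤ ∑ i, t i * c i ∧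
          p = ((a, b), a • α + ∑ i, t i • d i)} := by
  apply Set.Subset.antisymm
  · apply coneGen_subset
    · exact ⟨0, 0, 0, le_rfl, fun _ => le_rfl, le_rfl, by simp, by ext <;> simp⟩
    · rintro _ _ ⟨a, b, t, ha, ht, hb, hbt, rfl⟩ ⟨a', b', t', ha', ht', hb', hbt', rfl⟩
      refine ⟨a + a', b + b', t + t', add_nonneg ha ha', fun i => add_nonneg (ht i) (ht' i),
        add_nonneg hb hb', ?_, ?_⟩
      · simpa [add_mul, Finset.sum_add_distrib] using add_le_add hbt hbt'
      · simp only [Prod.mk_add_mk, Pi.add_apply, add_smul, Finset.sum_add_distrib,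
          add_add_add_comm]
    · intro s hs
      have hsingle (i : Fin r) : (0 : Fin r → ℝ) ≤ Pi.single i s := Pi.single_nonneg.2 hs
      rintro _ ((⟨i, rfl⟩ | ⟨i, rfl⟩) | rfl)
      · refine ⟨0, 0, Pi.single i s, le_rfl, hsingle i, le_rfl, ?_, ?_⟩
        · simpa [Pi.single_apply] using mul_nonneg hs (hc i)
        · simp [Pi.single_apply, ite_smul]
      · refine ⟨0, s * c i, Pi.single i s, le_rfl, hsingle i,
          mul_nonneg hs (hc i), ?_, ?_⟩
        · simp [Pi.single_apply]
        · simp [Pi.single_apply, ite_smul]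
      · exact ⟨s, 0, 0, hs, fun _ => le_rfl, le_rfl, by simp, by simp⟩
  · rintro _ ⟨a, b, t, ha, ht, hb, hbt, rfl⟩
    obtain ⟨u, hu0, hu1, hu⟩ : ∃ u : ℝ, 0 ≤ u ∧ u ≤ 1 ∧ u * ∑ i, t i * c i = b := by
      have hS := hb.trans hbt
      refine ⟨b / ∑ i, t i * c i, div_nonneg hb hS, div_le_one_of_le₀ hbt hS,
        div_mul_cancel_of_imp fun h => ?_⟩
      exact le_antisymm (h ▸ hbt) hb
    have key : (((a, b), a • α + ∑ i, t i • d i) : (ℝ × ℝ) × (Fin ρ → ℝ)) =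
        a • (((1 : ℝ), (0 : ℝ)), α) +
          ∑ i, (((1 - u) * t i) • (((0 : ℝ), (0 : ℝ)), d i)
            + (u * t i) • (((0 : ℝ), c i), d i)) := by
      refine Prod.ext (Prod.ext ?_ ?_) ?_
      · simp [Prod.fst_sum]
      · simp [Prod.fst_sum, Prod.snd_sum, ← hu, Finset.mul_sum, mul_assoc]
      · simp [Prod.snd_sum, ← add_smul, ← add_mul]
    rw [key]
    refine add_mem_coneGen (smul_mem_coneGen ha (Or.inr rfl)) (sum_mem_coneGen _ fun i _ => ?_)
    exact add_mem_coneGen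
      (smul_mem_coneGen (mul_nonneg (sub_nonneg.2 hu1) (ht i)) (Or.inl (Or.inl ⟨i, rfl⟩)))
      (smul_mem_coneGen (mul_nonneg hu0 (ht i)) (Or.inl (Or.inr ⟨i, rfl⟩)))
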